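/- In the AMOC model, define V(k) = S(k)² − S(m)². Then for every k < m the following algebraic identity holds: V(k) = [n(m−k)(n−m−k)/(k(n−k)m(n−m))]·(Σ_{i=1}^k(e(i)−ē_n))² − [n/(m(n−m))]·Σ_{i=k+1}^m(e(i)−ē_n)·(Σ_{i=1}^k(e(i)−ē_n) + Σ_{i=1}^m(e(i)−ē_n)) + 2d_n Σ_{i=k+1}^m(e(i)−ē_n) + 2d_n·[(m−k)/(n−k)]·Σ_{i=1}^k(e(i)−ē_n) + d_n²·(n−m)(k−m)/(n−k). Moreover m̂ = argmax{V(k) : k = 1,…,n−1}. -/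

import Mathlib

open Finset

/-- decomposition \eqref{eq_decomp_V}: in the AMOC model with
`V(k) = S(k)² - S(m)²`, for every `1 ≤ k < m` the stated algebraic identity
`V(k) = A_{k1} + A_{k2} + A_{k3} + A_{k4} + A_{k5}` holds; moreover the smallest
maximizer `m̂` of `|S(k)|` over `k = 1, …, n-1` is also the smallest maximizer of
`V(k)` over `k = 1, …, n-1`. -/
theorem V_decomposition_and_argmax
    (n m : ℕ) (μ dn : ℝ) (e : ℕ → ℝ)
    (hm1 : 1 ≤ m) (hmn : m < n)
    (X : ℕ → ℝ) (hX : ∀ i, X i = μ + (if m < i then dn else 0) + e i)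
    (S : ℕ → ℝ)
    (hS : ∀ k, S k = Real.sqrt ((n : ℝ) / ((k : ℝ) * ((n : ℝ) - (k : ℝ)))) *
      ∑ i ∈ Finset.Icc 1 k, (X i - (n : ℝ)⁻¹ * ∑ j ∈ Finset.Icc 1 n, X j))
    (V : ℕ → ℝ) (hV : ∀ k, V k = S k ^ 2 - S m ^ 2)
    (ebar : ℝ) (hebar : ebar = (n : ℝ)⁻¹ * ∑ i ∈ Finset.Icc 1 n, e i)
    (mh : ℕ) (hmh1 : mh ∈ Finset.Icc 1 (n - 1))
    (hmh2 : ∀ k ∈ Finset.Icc 1 (n - 1), |S k| ≤ |S mh|)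
    (hmh3 : ∀ k ∈ Finset.Icc 1 (n - 1), |S k| = |S mh| → mh ≤ k) :
    (∀ k : ℕ, 1 ≤ k → k < m →
      V k =
        ((n : ℝ) * ((m : ℝ) - (k : ℝ)) * ((n : ℝ) - (m : ℝ) - (k : ℝ)))
            / ((k : ℝ) * ((n : ℝ) - (k : ℝ)) * (m : ℝ) * ((n : ℝ) - (m : ℝ))) *
          (∑ i ∈ Finset.Icc 1 k, (e i - ebar)) ^ 2
        - (n : ℝ) / ((m : ℝ) * ((n : ℝ) - (m : ℝ))) *
            ((∑ i ∈ Finset.Icc (k + 1) m, (e i - ebar)) *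
              (∑ i ∈ Finset.Icc 1 k, (e i - ebar)
                + ∑ i ∈ Finset.Icc 1 m, (e i - ebar)))
        + 2 * dn * ∑ i ∈ Finset.Icc (k + 1) m, (e i - ebar)
        + 2 * dn * (((m : ℝ) - (k : ℝ)) / ((n : ℝ) - (k : ℝ))) *
            ∑ i ∈ Finset.Icc 1 k, (e i - ebar)
        + dn ^ 2 * (((n : ℝ) - (m : ℝ)) * ((k : ℝ) - (m : ℝ)))
            / ((n : ℝ) - (k : ℝ))) ∧
    (∀ k ∈ Finset.Icc 1 (n - 1), V k ≤ V mh) ∧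
    (∀ k ∈ Finset.Icc 1 (n - 1), V k = V mh → mh ≤ k) := by
  have hnpos : (0:ℝ) < n := by exact_mod_cast (by omega : 0 < n)
  have hmn' : (0:ℝ) < (n:ℝ) - m := by
    have : (m:ℝ) < n := by exact_mod_cast hmn
    linarith
  have hmpos : (0:ℝ) < m := by exact_mod_cast hm1
  have hXsum : ∑ j ∈ Finset.Icc 1 n, X j
      = n * μ + ((n:ℝ) - m) * dn + ∑ j ∈ Finset.Icc 1 n, e j := by
    have hf : (Finset.Icc 1 n).filter (fun i => m < i) = Finset.Icc (m + 1) n := by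
      ext i
      simp only [Finset.mem_filter, Finset.mem_Icc]
      omega
    simp only [hX, Finset.sum_add_distrib]
    rw [← Finset.sum_filter, hf]
    simp only [Finset.sum_const, Nat.card_Icc, nsmul_eq_mul]
    have h1 : ((n + 1 - (m + 1) : ℕ) : ℝ) = (n:ℝ) - m := by
      rw [show n + 1 - (m + 1) = n - m by omega, Nat.cast_sub hmn.le]
    rw [h1]
    simp
  have hpart : ∀ k, k ≤ m →
      ∑ i ∈ Finset.Icc 1 k, (X i - (n : ℝ)⁻¹ * ∑ j ∈ Finset.Icc 1 n, X j)
        = ∑ i ∈ Finset.Icc 1 k, (e i - ebar) - dn * k * ((n:ℝ) - m) / n := by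
    intro k hk
    have : ∀ i ∈ Finset.Icc 1 k, X i - (n : ℝ)⁻¹ * ∑ j ∈ Finset.Icc 1 n, X j
        = (e i - ebar) - dn * ((n:ℝ) - m) / n := by
      intro i hi
      have hi' := (Finset.mem_Icc.mp hi).2
      rw [hXsum, hX, if_neg (by omega), hebar]
      field_simp
      ring
    rw [Finset.sum_congr rfl this, Finset.sum_sub_distrib]
    simp only [Finset.sum_const, Nat.card_Icc, nsmul_eq_mul, Nat.add_sub_cancel]
    ring
  have hsq : ∀ k, 1 ≤ k → k ≤ m → S k ^ 2 = (n : ℝ) / ((k : ℝ) * ((n : ℝ) - (k : ℝ))) *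
      (∑ i ∈ Finset.Icc 1 k, (e i - ebar) - dn * k * ((n:ℝ) - m) / n) ^ 2 := by
    intro k hk1 hk
    have h1 : (k:ℝ) ≤ m := by exact_mod_cast hk
    have h2 : (0:ℝ) < k := by exact_mod_cast hk1
    have h3 : (0:ℝ) < (n:ℝ) - k := by linarith
    rw [hS, hpart k hk, mul_pow, Real.sq_sqrt (by positivity)]
  refine ⟨?_, ?_, ?_⟩
  · intro k hk1 hk
    have h1 : (k:ℝ) < m := by exact_mod_cast hk
    have h2 : (0:ℝ) < k := by exact_mod_cast hk1
    have h3 : (0:ℝ) < (n:ℝ) - k := by linarith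
    have hsplit : ∑ i ∈ Finset.Icc 1 m, (e i - ebar)
        = ∑ i ∈ Finset.Icc 1 k, (e i - ebar) + ∑ i ∈ Finset.Icc (k + 1) m, (e i - ebar) := by
      have hu : Finset.Icc 1 m = Finset.Icc 1 k ∪ Finset.Icc (k + 1) m := by
        ext i
        simp only [Finset.mem_union, Finset.mem_Icc]
        omega
      rw [hu, Finset.sum_union]
      rw [Finset.disjoint_left]
      intro i hi hj
      simp only [Finset.mem_Icc] at hi hj
      omega
    rw [hV, hsq k hk1 hk.le, hsq m hm1 le_rfl, hsplit]
    generalize ∑ i ∈ Finset.Icc 1 k, (e i - ebar) = A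
    generalize ∑ i ∈ Finset.Icc (k + 1) m, (e i - ebar) = B
    have a1 := h3.ne'
    have a2 := h2.ne'
    have a3 := hmn'.ne'
    have a4 := hmpos.ne'
    have a5 := hnpos.ne'
    field_simp
    ring
  · intro k hk
    have := sq_le_sq.mpr (hmh2 k hk)
    rw [hV, hV]
    linarith
  · intro k hk h
    rw [hV, hV] at h
    exact hmh3 k hk (sq_eq_sq_iff_abs_eq_abs _ _ |>.mp (by linarith))
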